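/- Let 1 < r < p ≤ q < ∞, let 𝒞 be a collection of dyadic cubes in ℝⁿ, let ω, σ be weights on ℝⁿ, and let (c_Q)_{Q∈𝒞} be nonnegative real numbers. Then the two quantities I := sup{ ‖Σ_{Q∈𝒞} c_Q (∫_Q fσ)^r 1_Q‖_{L^{q/r}_ω} : f ≥ 0, ‖f‖_{L^p_σ} ≤ 1 } and II := sup{ ‖Σ_{Q∈𝒞} c_Q σ(Q)^{r−1} |Q| ⟨gσ⟩_Q 1_Q‖_{L^{q/r}_ω} : g ≥ 0, ‖g‖_{L^{p/r}_σ} ≤ 1 } are comparable, with comparability constants depending only on p and r (in particular independent of (c_Q), ω, σ and 𝒞). Here ⟨h⟩_Q := |Q|^{−1}∫_Q h. -/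

import Mathlib

open MeasureTheory ENNReal Set

noncomputable section

/-- An axis-parallel (closed) cube in ℝⁿ with corner `corner` and side length `side > 0`. -/
structure Cube (n : ℕ) where
  corner : Fin n → ℝ
  side : ℝ
  side_pos : 0 < side

namespace Cube

/-- The set of points of the cube. -/
def carrier {n : ℕ} (Q : Cube n) : Set (Fin n → ℝ) :=
  {x | ∀ i, Q.corner i ≤ x i ∧ x i ≤ Q.corner i + Q.side}

/-- The volume `|Q|` of the cube. -/
def vol {n : ℕ} (Q : Cube n) : ℝ := Q.side ^ n

/-- `Q` is a cube of the standard dyadic grid: `Q = 2^{-j}([0,1]^n + m)`. -/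
def IsDyadic {n : ℕ} (Q : Cube n) : Prop :=
  ∃ (j : ℤ) (m : Fin n → ℤ),
    Q.side = (2 : ℝ) ^ (-j) ∧ ∀ i, Q.corner i = (m i : ℝ) * (2 : ℝ) ^ (-j)

end Cube

/-- `η`-sparseness of a collection of cubes: there are pairwise disjoint measurable
subsets `E Q ⊆ Q` with `|E Q| ≥ η |Q|`. -/
def IsSparse {n : ℕ} (η : ℝ) (S : Set (Cube n)) : Prop :=
  ∃ E : Cube n → Set (Fin n → ℝ),
    (∀ Q ∈ S, MeasurableSet (E Q)) ∧ (∀ Q ∈ S, E Q ⊆ Q.carrier) ∧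
    (S.Pairwise (fun Q Q' => Disjoint (E Q) (E Q'))) ∧
    (∀ Q ∈ S, ENNReal.ofReal (η * Q.vol) ≤ volume (E Q))

/-- A weight: a nonnegative locally integrable function on ℝⁿ. -/
def IsWeight {n : ℕ} (w : (Fin n → ℝ) → ℝ) : Prop :=
  MeasureTheory.LocallyIntegrable w volume ∧ ∀ x, 0 ≤ w x

/-- `ω(Q) = ∫_Q ω`. -/
def wMass {n : ℕ} (w : (Fin n → ℝ) → ℝ) (Q : Cube n) : ℝ≥0∞ :=
  ∫⁻ x in Q.carrier, ENNReal.ofReal (w x)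

/-- The weighted `L^s` (quasi)norm `‖f‖_{L^s_w} = (∫ |f|^s w)^{1/s}`, valued in `ℝ≥0∞`. -/
def wNorm {n : ℕ} (s : ℝ) (w f : (Fin n → ℝ) → ℝ) : ℝ≥0∞ :=
  (∫⁻ x, ENNReal.ofReal (|f x| ^ s) * ENNReal.ofReal (w x)) ^ (1 / s)

/-- The weighted `L^s` (quasi)norm of an `ℝ≥0∞`-valued function. -/
def eNorm {n : ℕ} (s : ℝ) (w : (Fin n → ℝ) → ℝ) (g : (Fin n → ℝ) → ℝ≥0∞) : ℝ≥0∞ :=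
  (∫⁻ x, g x ^ s * ENNReal.ofReal (w x)) ^ (1 / s)

/-- `Σ_{Q ∈ D} g(Q) 1_Q`. -/
def cubeSum {n : ℕ} (D : Set (Cube n)) (g : Cube n → ℝ≥0∞) (x : Fin n → ℝ) : ℝ≥0∞ :=
  ∑' Q : D, Q.1.carrier.indicator (fun _ => g Q.1) x

/-- The sparse operator `A^{r,α}_S f = (Σ_{Q∈S} (|Q|^{-α} ∫_Q f)^r 1_Q)^{1/r}`
(for nonnegative `f`; negative values are truncated). -/
def sparseOp {n : ℕ} (S : Set (Cube n)) (r α : ℝ) (f : (Fin n → ℝ) → ℝ)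
    (x : Fin n → ℝ) : ℝ≥0∞ :=
  (cubeSum S
      (fun Q => ((ENNReal.ofReal Q.vol) ^ (-α) * ∫⁻ y in Q.carrier, ENNReal.ofReal (f y)) ^ r)
      x) ^ (1 / r)

/-- The Hardy–Littlewood maximal function over axis-parallel cubes. -/
def maximal {n : ℕ} (w : (Fin n → ℝ) → ℝ) (x : Fin n → ℝ) : ℝ≥0∞ :=
  ⨆ (Q : Cube n) (_ : x ∈ Q.carrier),
    (ENNReal.ofReal Q.vol)⁻¹ * ∫⁻ y in Q.carrier, ENNReal.ofReal |w y|

/-- The Fujii–Wilson `A∞`-characteristic `[w]_{A∞} = sup_Q ω(Q)⁻¹ ∫_Q M(1_Q ω)`. -/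
def AinfChar {n : ℕ} (w : (Fin n → ℝ) → ℝ) : ℝ≥0∞ :=
  ⨆ Q : Cube n, (wMass w Q)⁻¹ * ∫⁻ x in Q.carrier, maximal (Q.carrier.indicator w) x

/-- The two-weight characteristic
`[ω,σ]_{A^α_{pq}(S)} = sup_{Q∈S} |Q|^{-α} ω(Q)^{1/q} σ(Q)^{1/p'}` (here `1/p' = 1 - 1/p`). -/
def twoWeightChar {n : ℕ} (p q α : ℝ) (S : Set (Cube n)) (w σ' : (Fin n → ℝ) → ℝ) : ℝ≥0∞ :=
  ⨆ Q ∈ S, (ENNReal.ofReal Q.vol) ^ (-α) * wMass w Q ^ (1 / q) * wMass σ' Q ^ (1 - 1 / p)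

/-- The one-weight characteristic
`[w]_{A_{pq}} = sup_Q (|Q|⁻¹ ∫_Q w^q)(|Q|⁻¹ ∫_Q w^{-p'})^{q/p'}`, `p' = p/(p-1)`. -/
def ApqChar {n : ℕ} (p q : ℝ) (w : (Fin n → ℝ) → ℝ) : ℝ≥0∞ :=
  ⨆ Q : Cube n,
    ((ENNReal.ofReal Q.vol)⁻¹ * ∫⁻ x in Q.carrier, (ENNReal.ofReal (w x)) ^ q) *
      ((ENNReal.ofReal Q.vol)⁻¹ *
          ∫⁻ x in Q.carrier, (ENNReal.ofReal (w x)) ^ (-(p / (p - 1)))) ^ (q / (p / (p - 1)))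

/-- The testing constant `𝒯`. -/
def testT {n : ℕ} (p q r α : ℝ) (S : Set (Cube n)) (w σ' : (Fin n → ℝ) → ℝ) : ℝ≥0∞ :=
  ⨆ R ∈ S,
    wMass σ' R ^ (-(r / p)) *
      eNorm (q / r) w
        (cubeSum {Q | Q ∈ S ∧ Q.carrier ⊆ R.carrier}
          (fun Q => (ENNReal.ofReal Q.vol) ^ (-(α * r)) * wMass σ' Q ^ r))

/-- The testing constant `𝒯*`; here `1/(q/r)' = 1 - r/q` and `(p/r)' = (p/r)/((p/r)-1)`. -/
def testTstar {n : ℕ} (p q r α : ℝ) (S : Set (Cube n)) (w σ' : (Fin n → ℝ) → ℝ) : ℝ≥0∞ :=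
  ⨆ R ∈ S,
    wMass w R ^ (-(1 - r / q)) *
      eNorm ((p / r) / (p / r - 1)) σ'
        (cubeSum {Q | Q ∈ S ∧ Q.carrier ⊆ R.carrier}
          (fun Q => (ENNReal.ofReal Q.vol) ^ (-(α * r)) * wMass σ' Q ^ (r - 1) * wMass w Q))

/-- The operator (quasi)norm of `A^{r,α}_S(·σ) : L^p_σ → L^q_ω`, i.e. the least constant `K`
with `‖A^{r,α}_S(fσ)‖_{L^q_ω} ≤ K ‖f‖_{L^p_σ}` for all `f`. -/
def sparseOpNorm {n : ℕ} (p q r α : ℝ) (S : Set (Cube n)) (w σ' : (Fin n → ℝ) → ℝ) : ℝ≥0∞ :=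
  sInf {K : ℝ≥0∞ | ∀ f : (Fin n → ℝ) → ℝ, Measurable f →
    eNorm q w (sparseOp S r α (fun y => f y * σ' y)) ≤ K * wNorm p σ' f}

/-- The quantity `I` of the linearization lemma. -/
def quantI {n : ℕ} (p q r : ℝ) (D : Set (Cube n)) (ω σ' : (Fin n → ℝ) → ℝ)
    (c : Cube n → ℝ) : ℝ≥0∞ :=
  ⨆ (f : (Fin n → ℝ) → ℝ) (_ : Measurable f) (_ : ∀ x, 0 ≤ f x) (_ : wNorm p σ' f ≤ 1),
    eNorm (q / r) ω
      (cubeSum D fun Q =>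
        ENNReal.ofReal (c Q) * (∫⁻ y in Q.carrier, ENNReal.ofReal (f y * σ' y)) ^ r)

/-- The quantity `II` of the linearization lemma, with `σ(Q)^{r-1} |Q| ⟨gσ⟩_Q`. -/
def quantII {n : ℕ} (p q r : ℝ) (D : Set (Cube n)) (ω σ' : (Fin n → ℝ) → ℝ)
    (c : Cube n → ℝ) : ℝ≥0∞ :=
  ⨆ (g : (Fin n → ℝ) → ℝ) (_ : Measurable g) (_ : ∀ x, 0 ≤ g x) (_ : wNorm (p / r) σ' g ≤ 1),
    eNorm (q / r) ω
      (cubeSum D fun Q =>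
        ENNReal.ofReal (c Q) * wMass σ' Q ^ (r - 1) *
          (ENNReal.ofReal Q.vol *
            ((ENNReal.ofReal Q.vol)⁻¹ * ∫⁻ y in Q.carrier, ENNReal.ofReal (g y * σ' y))))

section Laminar

variable {α ι : Type*} [MeasurableSpace α] {μ : Measure α} {S : ι → Set α}

lemma mul_measure_biUnion_le_of_laminar (hS : ∀ i, MeasurableSet (S i))
    (hnest : ∀ i j, S i ⊆ S j ∨ S j ⊆ S i ∨ Disjoint (S i) (S j)) (h : α → ℝ≥0∞) (t : ℝ≥0∞)
    (F : Finset ι) (hF : ∀ i ∈ F, t * μ (S i) ≤ ∫⁻ x in S i, h x ∂μ) :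
    t * μ (⋃ i ∈ F, S i) ≤ ∫⁻ x in ⋃ i ∈ F, S i, h x ∂μ := by
  classical
  induction F using Finset.strongInduction with
  | H F ih =>
    rcases F.eq_empty_or_nonempty with rfl | ⟨a, ha⟩
    · simp
    by_cases hsub : ∃ j ∈ F.erase a, S a ⊆ S j
    · obtain ⟨j, hj, haj⟩ := hsub
      have hU : ⋃ i ∈ F, S i = ⋃ i ∈ F.erase a, S i := by
        conv_lhs => rw [← Finset.insert_erase ha]
        rw [Finset.set_biUnion_insert, union_eq_right]
        exact haj.trans (subset_biUnion_of_mem (u := S) (Finset.mem_coe.2 hj))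
      rw [hU]
      exact ih _ (Finset.erase_ssubset ha) fun i hi => hF i (Finset.mem_of_mem_erase hi)
    · push Not at hsub
      set G := (F.erase a).filter fun i => ¬ S i ⊆ S a with hG
      have hGF : G ⊂ F := (Finset.filter_subset _ _).trans_ssubset (Finset.erase_ssubset ha)
      have hU : ⋃ i ∈ F, S i = S a ∪ ⋃ i ∈ G, S i := by
        apply Subset.antisymm
        · refine iUnion₂_subset fun i hi => ?_
          by_cases hia : S i ⊆ S a
          · exact hia.trans subset_union_left
          · have hne : i ≠ a := by rintro rfl; exact hia Subset.rfl
            have hiG : i ∈ G := by simp [hG, hi, hia, hne]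
            exact (subset_biUnion_of_mem (u := S) (Finset.mem_coe.2 hiG)).trans
              subset_union_right
        · exact union_subset (subset_biUnion_of_mem (u := S) (Finset.mem_coe.2 ha))
            (biUnion_subset_biUnion_left fun i hi => hGF.1 hi)
      have hdisj : Disjoint (S a) (⋃ i ∈ G, S i) := by
        refine disjoint_iUnion₂_right.2 fun i hi => ?_
        obtain ⟨hi1, hi2⟩ := Finset.mem_filter.1 hi
        rcases hnest a i with h1 | h1 | h1
        · exact absurd h1 (hsub i hi1)
        · exact absurd h1 hi2
        · exact h1
      have hm : MeasurableSet (⋃ i ∈ G, S i) := G.measurableSet_biUnion fun i _ => hS i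
      rw [hU, measure_union hdisj hm, lintegral_union hm hdisj, mul_add]
      exact add_le_add (hF a ha) (ih G hGF fun i hi => hF i (hGF.1 hi))

/-- The maximal function of a family of sets `S i` with respect to a measure `μ`. -/
def laminarMax (μ : Measure α) (S : ι → Set α) (g : α → ℝ≥0∞) (x : α) : ℝ≥0∞ :=
  ⨆ i, (S i).indicator (fun _ => (μ (S i))⁻¹ * ∫⁻ y in S i, g y ∂μ) x

lemma measurable_laminarMax [Countable ι] (hS : ∀ i, MeasurableSet (S i)) (g : α → ℝ≥0∞) :
    Measurable (laminarMax μ S g) :=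
  Measurable.iSup fun i => measurable_const.indicator (hS i)

lemma average_le_laminarMax (g : α → ℝ≥0∞) {i : ι} {x : α} (hx : x ∈ S i) :
    (μ (S i))⁻¹ * ∫⁻ y in S i, g y ∂μ ≤ laminarMax μ S g x := by
  refine le_trans ?_ (le_iSup _ i)
  rw [indicator_of_mem hx]

lemma mul_measure_lt_laminarMax_le [Countable ι] (hS : ∀ i, MeasurableSet (S i))
    (hnest : ∀ i j, S i ⊆ S j ∨ S j ⊆ S i ∨ Disjoint (S i) (S j)) (hfin : ∀ i, μ (S i) ≠ ⊤)
    {g : α → ℝ} (hg : Measurable g) {t : ℝ} :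
    ENNReal.ofReal t * μ {x | ENNReal.ofReal t < laminarMax μ S (fun y => ENNReal.ofReal (g y)) x}
      ≤ 2 * ∫⁻ x in {x | t < 2 * g x}, ENNReal.ofReal (g x) ∂μ := by
  classical
  set G : α → ℝ≥0∞ := fun y => ENNReal.ofReal (g y) with hG
  set E : Set α := {x | t < 2 * g x} with hE
  have hEm : MeasurableSet E := measurableSet_lt measurable_const (hg.const_mul 2)
  set h : α → ℝ≥0∞ := fun x => 2 * E.indicator G x with hh
  have hlevel : ∀ i, ENNReal.ofReal t < (μ (S i))⁻¹ * ∫⁻ y in S i, G y ∂μ →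
      ENNReal.ofReal t * μ (S i) ≤ ∫⁻ x in S i, h x ∂μ := by
    intro i hi
    rcases eq_or_ne (μ (S i)) 0 with h0 | h0
    · simp [h0]
    have h1 : ENNReal.ofReal t * μ (S i) ≤ ∫⁻ y in S i, G y ∂μ := by
      rw [← ENNReal.le_div_iff_mul_le (Or.inl h0) (Or.inl (hfin i)), div_eq_mul_inv, mul_comm]
      exact hi.le
    have h2 : ∀ y, 2 * G y ≤ h y + ENNReal.ofReal t := by
      intro y
      by_cases hy : y ∈ E
      · simp [hh, indicator_of_mem hy]
      · have : 2 * g y ≤ t := not_lt.1 hy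
        calc 2 * G y = ENNReal.ofReal (2 * g y) := by
              rw [ENNReal.ofReal_mul (by norm_num)]; simp [hG]
          _ ≤ ENNReal.ofReal t := ENNReal.ofReal_le_ofReal this
          _ ≤ _ := le_add_self
    have h3 : 2 * (ENNReal.ofReal t * μ (S i)) ≤
        ∫⁻ x in S i, h x ∂μ + ENNReal.ofReal t * μ (S i) := by
      calc 2 * (ENNReal.ofReal t * μ (S i)) ≤ 2 * ∫⁻ y in S i, G y ∂μ := by gcongr
        _ = ∫⁻ y in S i, 2 * G y ∂μ := (lintegral_const_mul' _ _ (by simp)).symm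
        _ ≤ ∫⁻ y in S i, (h y + ENNReal.ofReal t) ∂μ := lintegral_mono h2
        _ = _ := by rw [lintegral_add_right _ measurable_const, setLIntegral_const]
    rw [two_mul] at h3
    exact (ENNReal.add_le_add_iff_right (ENNReal.mul_ne_top (by simp) (hfin i))).1 h3
  let I := {i // ENNReal.ofReal t < (μ (S i))⁻¹ * ∫⁻ y in S i, G y ∂μ}
  have hset : {x | ENNReal.ofReal t < laminarMax μ S G x} ⊆
      ⋃ F : Finset I, ⋃ i ∈ F, S i.1 := by
    intro x hx
    obtain ⟨i, hi⟩ := lt_iSup_iff.1 (show ENNReal.ofReal t < laminarMax μ S G x from hx)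
    by_cases hxi : x ∈ S i
    · rw [indicator_of_mem hxi] at hi
      exact mem_iUnion.2 ⟨{⟨i, hi⟩}, by simpa using hxi⟩
    · simp [indicator_of_notMem hxi] at hi
  have hdir : Directed (· ⊆ ·) fun F : Finset I => ⋃ i ∈ F, S i.1 :=
    directed_of_isDirected_le fun F F' hFF => biUnion_subset_biUnion_left fun _ hi =>
      Finset.mem_of_subset hFF hi
  calc ENNReal.ofReal t * μ {x | ENNReal.ofReal t < laminarMax μ S G x}
      ≤ ENNReal.ofReal t * μ (⋃ F : Finset I, ⋃ i ∈ F, S i.1) := by gcongr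
    _ = ⨆ F : Finset I, ENNReal.ofReal t * μ (⋃ i ∈ F, S i.1) := by
        rw [hdir.measure_iUnion, ENNReal.mul_iSup]
    _ ≤ ∫⁻ x, h x ∂μ := iSup_le fun F =>
        (mul_measure_biUnion_le_of_laminar (S := fun i : I => S i.1) (fun i => hS i.1)
          (fun i j => hnest i.1 j.1) h _ F fun i _ => hlevel i.1 i.2).trans
          (setLIntegral_le_lintegral _ _)
    _ = _ := by rw [lintegral_const_mul' _ _ (by simp), lintegral_indicator hEm]

end Laminar

section StrongType

variable {α : Type*} [MeasurableSpace α] {μ : Measure α}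

lemma lintegral_withDensity_ofReal {w : α → ℝ} (hw : AEMeasurable w μ) {f : α → ℝ≥0∞}
    (hf : Measurable f) :
    ∫⁻ x, f x ∂μ.withDensity (fun x => ENNReal.ofReal (w x)) =
      ∫⁻ x, f x * ENNReal.ofReal (w x) ∂μ := by
  rw [lintegral_withDensity_eq_lintegral_mul₀ hw.ennreal_ofReal hf.aemeasurable]
  simp [mul_comm]

lemma lintegral_rpow_withDensity_self {g : α → ℝ} (hg : Measurable g) (hg0 : ∀ x, 0 ≤ g x)
    {s : ℝ} (hs : 1 < s) :
    ∫⁻ x, ENNReal.ofReal ((2 * g x) ^ (s - 1)) ∂μ.withDensity (fun x => ENNReal.ofReal (g x)) =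
      ENNReal.ofReal (2 ^ (s - 1)) * ∫⁻ x, ENNReal.ofReal (g x ^ s) ∂μ := by
  rw [lintegral_withDensity_ofReal hg.aemeasurable (by fun_prop),
    ← lintegral_const_mul' _ _ (by simp)]
  refine lintegral_congr fun x => ?_
  have h2 : (0 : ℝ) ≤ 2 * g x := mul_nonneg (by norm_num) (hg0 x)
  rw [← ENNReal.ofReal_mul (Real.rpow_nonneg h2 _), ← ENNReal.ofReal_mul (by positivity),
    Real.mul_rpow (by norm_num) (hg0 x), mul_assoc]
  congr 2
  rcases (hg0 x).eq_or_lt with h | h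
  · rw [← h, Real.zero_rpow (by linarith : s ≠ 0), mul_zero]
  · nth_rw 2 [← Real.rpow_one (g x)]
    rw [← Real.rpow_add h]; congr 1; ring

variable {M : α → ℝ≥0∞} {g : α → ℝ}

lemma ae_lt_top_of_weakType (hg : Measurable g) (hg0 : ∀ x, 0 ≤ g x) {s : ℝ} (hs : 1 < s)
    (hfin : ∫⁻ x, ENNReal.ofReal (g x ^ s) ∂μ ≠ ⊤)
    (hweak : ∀ t : ℝ, 0 < t → ENNReal.ofReal t * μ {x | ENNReal.ofReal t < M x} ≤
      2 * ∫⁻ x in {x | t < 2 * g x}, ENNReal.ofReal (g x) ∂μ) :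
    ∀ᵐ x ∂μ, M x < ⊤ := by
  set ν := μ.withDensity (fun x => ENNReal.ofReal (g x)) with hν
  have hm : ∀ t : ℝ, MeasurableSet {x | t < 2 * g x} := fun t =>
    measurableSet_lt measurable_const (hg.const_mul 2)
  have hK : ν {x | 1 < 2 * g x} ≠ ⊤ := by
    refine ne_top_of_le_ne_top ?_ (?_ : _ ≤ ∫⁻ x, ENNReal.ofReal ((2 * g x) ^ (s - 1)) ∂ν)
    · rw [hν, lintegral_rpow_withDensity_self hg hg0 hs]
      exact ENNReal.mul_ne_top (by simp) hfin
    · rw [← lintegral_indicator_one (hm 1)]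
      refine lintegral_mono (indicator_le' (fun y hy => ?_) fun _ _ => zero_le)
      simpa using Real.one_le_rpow (le_of_lt hy) (by linarith)
  have hbound : ∀ k : ℕ, k * μ {x | M x = ⊤} ≤ 2 * ν {x | 1 < 2 * g x} := by
    intro k
    rcases Nat.eq_zero_or_pos k with rfl | hk
    · simp
    have hk1 : (1 : ℝ) ≤ k := by exact_mod_cast hk
    calc (k : ℝ≥0∞) * μ {x | M x = ⊤}
        ≤ ENNReal.ofReal k * μ {x | ENNReal.ofReal k < M x} := by
          rw [ENNReal.ofReal_natCast]
          gcongr with x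
          intro hx; rw [hx]; simp
      _ ≤ 2 * ν {x | k < 2 * g x} := by
          rw [hν, withDensity_apply _ (hm k)]
          exact hweak k (by linarith)
      _ ≤ _ := by
          gcongr
  have hzero : μ {x | M x = ⊤} = 0 := by
    by_contra h
    have hlt : 2 * ν {x | 1 < 2 * g x} / μ {x | M x = ⊤} ≠ ⊤ :=
      ENNReal.div_ne_top (ENNReal.mul_ne_top (by simp) hK) h
    obtain ⟨k, hk⟩ := ENNReal.exists_nat_gt hlt
    refine absurd (hbound k) (not_le.2 ?_)
    rcases eq_or_ne (μ {x | M x = ⊤}) ⊤ with h' | h'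
    · have h1 : ⊤ ≤ 2 * ν {x | 1 < 2 * g x} := by simpa [h'] using hbound 1
      exact absurd (top_le_iff.1 h1) (ENNReal.mul_ne_top (by simp) hK)
    · exact (ENNReal.div_lt_iff (Or.inl h) (Or.inl h')).1 hk
  filter_upwards [measure_eq_zero_iff_ae_notMem.1 hzero] with x hx
  exact lt_top_iff_ne_top.2 hx

lemma lintegral_rpow_le_of_weakType (hM : Measurable M) (hg : Measurable g) (hg0 : ∀ x, 0 ≤ g x)
    {s : ℝ} (hs : 1 < s)
    (hweak : ∀ t : ℝ, 0 < t → ENNReal.ofReal t * μ {x | ENNReal.ofReal t < M x} ≤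
      2 * ∫⁻ x in {x | t < 2 * g x}, ENNReal.ofReal (g x) ∂μ) :
    ∫⁻ x, ENNReal.ofReal ((M x).toReal ^ s) ∂μ ≤
      ENNReal.ofReal (2 ^ s * (s / (s - 1))) * ∫⁻ x, ENNReal.ofReal (g x ^ s) ∂μ := by
  set ν := μ.withDensity (fun x => ENNReal.ofReal (g x)) with hν
  have hs1 : 0 < s - 1 := by linarith
  have hm : ∀ t : ℝ, MeasurableSet {x | t < 2 * g x} := fun t =>
    measurableSet_lt measurable_const (hg.const_mul 2)
  have hlayer : ENNReal.ofReal (2 ^ (s - 1)) * ∫⁻ x, ENNReal.ofReal (g x ^ s) ∂μ =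
      ENNReal.ofReal (s - 1) *
        ∫⁻ t in Ioi (0 : ℝ), ν {x | t < 2 * g x} * ENNReal.ofReal (t ^ (s - 1 - 1)) := by
    rw [← lintegral_rpow_withDensity_self hg hg0 hs]
    exact lintegral_rpow_eq_lintegral_meas_lt_mul ν
      (Filter.Eventually.of_forall fun x => mul_nonneg (by norm_num) (hg0 x))
      (hg.const_mul 2).aemeasurable hs1
  rw [lintegral_rpow_eq_lintegral_meas_lt_mul μ (Filter.Eventually.of_forall fun x => by simp)
    hM.ennreal_toReal.aemeasurable (by linarith)]
  have hpt : ∀ t ∈ Ioi (0 : ℝ), μ {x | t < (M x).toReal} * ENNReal.ofReal (t ^ (s - 1)) ≤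
      2 * (ν {x | t < 2 * g x} * ENNReal.ofReal (t ^ (s - 1 - 1))) := by
    intro t ht
    have ht0 : 0 < t := ht
    have hsplit : t ^ (s - 1) = t * t ^ (s - 1 - 1) := by
      rw [Real.rpow_sub_one ht0.ne' (s - 1)]; field_simp
    rw [hsplit, ENNReal.ofReal_mul ht0.le, ← mul_assoc, ← mul_assoc]
    refine mul_le_mul_left ?_ _
    calc μ {x | t < (M x).toReal} * ENNReal.ofReal t
        ≤ ENNReal.ofReal t * μ {x | ENNReal.ofReal t < M x} := by
          rw [mul_comm]
          gcongr with x
          exact fun hx => (ENNReal.ofReal_lt_ofReal_iff (ht0.trans hx)).2 hx |>.trans_le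
            ENNReal.ofReal_toReal_le
      _ ≤ _ := by
          rw [hν, withDensity_apply _ (hm t)]
          exact hweak t ht0
  calc ENNReal.ofReal s *
        ∫⁻ t in Ioi (0 : ℝ), μ {x | t < (M x).toReal} * ENNReal.ofReal (t ^ (s - 1))
      ≤ ENNReal.ofReal s * (2 *
        ∫⁻ t in Ioi (0 : ℝ), ν {x | t < 2 * g x} * ENNReal.ofReal (t ^ (s - 1 - 1))) := by
        rw [← lintegral_const_mul' 2 _ (by simp)]
        gcongr 1
        exact setLIntegral_mono' measurableSet_Ioi hpt
    _ = ENNReal.ofReal (s / (s - 1) * 2) * (ENNReal.ofReal (s - 1) *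
        ∫⁻ t in Ioi (0 : ℝ), ν {x | t < 2 * g x} * ENNReal.ofReal (t ^ (s - 1 - 1))) := by
        rw [← mul_assoc, ← mul_assoc, ← ENNReal.ofReal_mul (by positivity)]
        congr 1
        rw [show (2 : ℝ≥0∞) = ENNReal.ofReal 2 by simp, ← ENNReal.ofReal_mul (by linarith)]
        congr 1
        field_simp
    _ = _ := by
        rw [← hlayer, ← mul_assoc, ← ENNReal.ofReal_mul (by positivity)]
        congr 2
        rw [Real.rpow_sub_one (by norm_num)]
        ring

end StrongType

section Dyadic

variable {n : ℕ}

/-- The half-open dyadic cube `2^{-j}([0,1)^n + m)`, indexed by `(j, m)`. -/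
def dyadicCell (i : ℤ × (Fin n → ℤ)) : Set (Fin n → ℝ) :=
  {x | ∀ k, ⌊x k * 2 ^ i.1⌋ = i.2 k}

lemma measurableSet_dyadicCell (i : ℤ × (Fin n → ℤ)) : MeasurableSet (dyadicCell i) := by
  have h : dyadicCell i = ⋂ k, (fun x : Fin n → ℝ => ⌊x k * 2 ^ i.1⌋) ⁻¹' {i.2 k} := by
    ext x; simp [dyadicCell]
  rw [h]
  exact MeasurableSet.iInter fun k =>
    (Int.measurable_floor.comp ((measurable_pi_apply k).mul_const _)) (measurableSet_singleton _)

lemma dyadicCell_subset_or_disjoint {i i' : ℤ × (Fin n → ℤ)} (h : i'.1 ≤ i.1) :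
    dyadicCell i ⊆ dyadicCell i' ∨ Disjoint (dyadicCell i) (dyadicCell i') := by
  obtain ⟨d, hd⟩ := Int.eq_ofNat_of_zero_le (sub_nonneg.2 h)
  have hfloor : ∀ a : ℝ, ⌊a * 2 ^ i'.1⌋ = ⌊a * 2 ^ i.1⌋ / ((2 ^ d : ℕ) : ℤ) := by
    intro a
    rw [← Int.floor_div_natCast]
    congr 1
    have hi : i.1 = i'.1 + d := by omega
    rw [hi, zpow_add₀ (by norm_num)]
    push_cast
    rw [zpow_natCast, ← mul_assoc, mul_div_cancel_right₀ _ (by positivity)]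
  refine or_iff_not_imp_right.2 fun hdisj => ?_
  obtain ⟨x, hx, hx'⟩ := not_disjoint_iff.1 hdisj
  intro y hy k
  rw [hfloor, hy k, ← hx k, ← hfloor, hx' k]

lemma dyadicCell_nested (i i' : ℤ × (Fin n → ℤ)) :
    dyadicCell i ⊆ dyadicCell i' ∨ dyadicCell i' ⊆ dyadicCell i ∨
      Disjoint (dyadicCell i) (dyadicCell i') := by
  rcases le_total i'.1 i.1 with h | h
  · exact (dyadicCell_subset_or_disjoint h).imp_right Or.inr
  · exact Or.inr ((dyadicCell_subset_or_disjoint h).imp_right fun hd => hd.symm)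

lemma dyadicCell_eq_pi_Ico (i : ℤ × (Fin n → ℤ)) :
    dyadicCell i = univ.pi fun k =>
      Ico ((i.2 k : ℝ) * 2 ^ (-i.1)) ((i.2 k : ℝ) * 2 ^ (-i.1) + 2 ^ (-i.1)) := by
  ext x
  have h2 : (0 : ℝ) < 2 ^ i.1 := by positivity
  simp only [dyadicCell, mem_ofPred_eq, mem_univ_pi, mem_Ico, Int.floor_eq_iff, zpow_neg]
  refine forall_congr' fun k => and_congr ?_ ?_
  · rw [← div_eq_mul_inv, div_le_iff₀ h2]
  · rw [← add_one_mul, ← div_eq_mul_inv, lt_div_iff₀ h2]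

lemma Cube.carrier_eq_Icc (Q : Cube n) :
    Q.carrier = Icc Q.corner (fun k => Q.corner k + Q.side) := by
  ext x
  simp [Cube.carrier, Pi.le_def, forall_and]

lemma Cube.measurableSet_carrier (Q : Cube n) : MeasurableSet Q.carrier := by
  rw [Q.carrier_eq_Icc]; exact measurableSet_Icc

lemma Cube.IsDyadic.exists_dyadicCell_ae_eq {Q : Cube n} (hQ : Q.IsDyadic) :
    ∃ i : ℤ × (Fin n → ℤ), dyadicCell i =ᵐ[volume] Q.carrier := by
  obtain ⟨j, m, hside, hcorner⟩ := hQ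
  refine ⟨(j, m), ?_⟩
  have hc : Q.corner = fun k => (m k : ℝ) * 2 ^ (-j) := funext hcorner
  rw [dyadicCell_eq_pi_Ico, Q.carrier_eq_Icc, hc, hside]
  exact Measure.univ_pi_Ico_ae_eq_Icc

end Dyadic

section Weight

variable {n : ℕ} {w : (Fin n → ℝ) → ℝ}

/-- The measure `w dx`. -/
def weightMeasure (w : (Fin n → ℝ) → ℝ) : Measure (Fin n → ℝ) :=
  volume.withDensity fun x => ENNReal.ofReal (w x)

lemma IsWeight.aemeasurable (hw : IsWeight w) : AEMeasurable w volume :=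
  hw.1.aestronglyMeasurable.aemeasurable

lemma weightMeasure_carrier (Q : Cube n) : weightMeasure w Q.carrier = wMass w Q :=
  withDensity_apply _ Q.measurableSet_carrier

lemma IsWeight.weightMeasure_carrier_ne_top (hw : IsWeight w) (Q : Cube n) :
    weightMeasure w Q.carrier ≠ ⊤ := by
  rw [weightMeasure_carrier, wMass, Q.carrier_eq_Icc]
  exact ((hw.1.integrableOn_isCompact isCompact_Icc).lintegral_lt_top).ne

lemma IsWeight.lintegral_weightMeasure (hw : IsWeight w) {f : (Fin n → ℝ) → ℝ≥0∞}
    (hf : Measurable f) :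
    ∫⁻ x, f x ∂weightMeasure w = ∫⁻ x, f x * ENNReal.ofReal (w x) :=
  lintegral_withDensity_ofReal hw.aemeasurable hf

lemma IsWeight.setLIntegral_weightMeasure (hw : IsWeight w) {f : (Fin n → ℝ) → ℝ}
    (hf : Measurable f) (hf0 : ∀ x, 0 ≤ f x) (Q : Cube n) :
    ∫⁻ x in Q.carrier, ENNReal.ofReal (f x) ∂weightMeasure w =
      ∫⁻ x in Q.carrier, ENNReal.ofReal (f x * w x) := by
  rw [weightMeasure, restrict_withDensity Q.measurableSet_carrier,
    lintegral_withDensity_ofReal hw.aemeasurable.restrict hf.ennreal_ofReal]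
  simp_rw [ENNReal.ofReal_mul (hf0 _)]

lemma IsWeight.wNorm_le_one_iff (hw : IsWeight w) {f : (Fin n → ℝ) → ℝ} (hf : Measurable f)
    (hf0 : ∀ x, 0 ≤ f x) {s : ℝ} (hs : 0 < s) :
    wNorm s w f ≤ 1 ↔ ∫⁻ x, ENNReal.ofReal (f x ^ s) ∂weightMeasure w ≤ 1 := by
  rw [hw.lintegral_weightMeasure (hf.pow_const s).ennreal_ofReal, wNorm]
  simp_rw [abs_of_nonneg (hf0 _)]
  simpa using ENNReal.rpow_le_rpow_iff (y := 1) (one_div_pos.2 hs)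

end Weight

section Comparison

variable {n : ℕ}

lemma Cube.vol_mul_inv_mul (Q : Cube n) (a : ℝ≥0∞) :
    ENNReal.ofReal Q.vol * ((ENNReal.ofReal Q.vol)⁻¹ * a) = a := by
  have h : 0 < Q.vol := pow_pos Q.side_pos n
  rw [← mul_assoc, ENNReal.mul_inv_cancel (by simpa using h) (by simp), one_mul]

lemma cubeSum_mono {D : Set (Cube n)} {g h : Cube n → ℝ≥0∞} (hgh : ∀ Q ∈ D, g Q ≤ h Q)
    (x : Fin n → ℝ) : cubeSum D g x ≤ cubeSum D h x :=
  ENNReal.tsum_le_tsum fun Q => indicator_le_indicator (hgh Q.1 Q.2)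

lemma cubeSum_const_mul (D : Set (Cube n)) (K : ℝ≥0∞) (g : Cube n → ℝ≥0∞) (x : Fin n → ℝ) :
    cubeSum D (fun Q => K * g Q) x = K * cubeSum D g x := by
  rw [cubeSum, cubeSum, ← ENNReal.tsum_mul_left]
  exact tsum_congr fun Q => by rw [← indicator_const_mul]

lemma eNorm_cubeSum_le {s : ℝ} (hs : 0 < s) (w : (Fin n → ℝ) → ℝ) {D : Set (Cube n)}
    {K : ℝ≥0∞} (hK : K ≠ ⊤) {g h : Cube n → ℝ≥0∞} (hgh : ∀ Q ∈ D, g Q ≤ K * h Q) :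
    eNorm s w (cubeSum D g) ≤ K * eNorm s w (cubeSum D h) := by
  have hroot : K * eNorm s w (cubeSum D h) =
      (∫⁻ x, (K * cubeSum D h x) ^ s * ENNReal.ofReal (w x)) ^ (1 / s) := by
    simp_rw [ENNReal.mul_rpow_of_nonneg _ _ hs.le, mul_assoc]
    rw [lintegral_const_mul' _ _ (ENNReal.rpow_ne_top_of_nonneg hs.le hK),
      ENNReal.mul_rpow_of_nonneg _ _ (by positivity), ← ENNReal.rpow_mul,
      mul_one_div_cancel hs.ne', ENNReal.rpow_one, eNorm]
  rw [hroot, eNorm]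
  gcongr with x
  exact (cubeSum_mono hgh x).trans_eq (cubeSum_const_mul D K h x)

lemma rpow_lintegral_le_measure_rpow_mul {α : Type*} [MeasurableSpace α] (μ : Measure α)
    {f : α → ℝ≥0∞} (hf : AEMeasurable f μ) {r : ℝ} (hr : 1 < r) :
    (∫⁻ x, f x ∂μ) ^ r ≤ μ univ ^ (r - 1) * ∫⁻ x, f x ^ r ∂μ := by
  have hr0 : 0 < r := by linarith
  have hpq : r.HolderConjugate (r / (r - 1)) := Real.HolderConjugate.conjExponent hr
  have h := ENNReal.lintegral_mul_le_Lp_mul_Lq μ hpq hf (aemeasurable_const (b := 1))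
  simp only [Pi.mul_apply, mul_one, ENNReal.one_rpow, lintegral_const, one_mul] at h
  calc (∫⁻ x, f x ∂μ) ^ r
      ≤ ((∫⁻ x, f x ^ r ∂μ) ^ (1 / r) * μ univ ^ (1 / (r / (r - 1)))) ^ r := by gcongr
    _ = _ := by
      rw [ENNReal.mul_rpow_of_nonneg _ _ hr0.le, ← ENNReal.rpow_mul, ← ENNReal.rpow_mul,
        one_div_mul_cancel hr0.ne', ENNReal.rpow_one, mul_comm]
      congr 2
      field_simp

lemma measure_rpow_mul_setLIntegral_le {α : Type*} [MeasurableSpace α] {μ : Measure α}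
    {E : Set α} (hE : MeasurableSet E) (hfin : μ E ≠ ⊤) {G M : α → ℝ≥0∞}
    (hM : ∀ᵐ x ∂μ, x ∈ E → (μ E)⁻¹ * ∫⁻ y in E, G y ∂μ ≤ M x) {r : ℝ} (hr : 1 < r) :
    μ E ^ (r - 1) * ∫⁻ x in E, G x ∂μ ≤ (∫⁻ x in E, M x ^ (1 / r) ∂μ) ^ r := by
  have hr0 : 0 < r := by linarith
  rcases eq_or_ne (μ E) 0 with h0 | h0
  · simp [h0, ENNReal.zero_rpow_of_pos (sub_pos.2 hr)]
  set A := (μ E)⁻¹ * ∫⁻ y in E, G y ∂μ with hA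
  have hint : ∫⁻ y in E, G y ∂μ = μ E * A := by
    rw [hA, ← mul_assoc, ENNReal.mul_inv_cancel h0 hfin, one_mul]
  have hle : A ^ (1 / r) * μ E ≤ ∫⁻ x in E, M x ^ (1 / r) ∂μ := by
    rw [← setLIntegral_const]
    refine setLIntegral_mono_ae' hE ?_
    filter_upwards [hM] with x hx hxE
    exact ENNReal.rpow_le_rpow (hx hxE) (by positivity)
  calc μ E ^ (r - 1) * ∫⁻ x in E, G x ∂μ = (A ^ (1 / r) * μ E) ^ r := by
        rw [hint, ENNReal.mul_rpow_of_nonneg _ _ hr0.le, ← ENNReal.rpow_mul,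
          one_div_mul_cancel hr0.ne', ENNReal.rpow_one, ← mul_assoc, mul_comm A]
        congr 1
        nth_rw 2 [← ENNReal.rpow_one (μ E)]
        rw [← ENNReal.rpow_add _ _ h0 hfin]
        congr 1; ring
    _ ≤ _ := by gcongr

variable {p q r : ℝ} {D : Set (Cube n)} {ω σ' : (Fin n → ℝ) → ℝ} {c : Cube n → ℝ}

lemma quantI_le_quantII (hr : 1 < r) (hrp : r < p) (hpq : p ≤ q) (hσ : IsWeight σ') :
    quantI p q r D ω σ' c ≤ quantII p q r D ω σ' c := by
  have hr0 : 0 < r := by linarith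
  refine iSup_le fun f => iSup_le fun hf => iSup_le fun hf0 => iSup_le fun hfn => ?_
  have hg0 : ∀ x, 0 ≤ f x ^ r := fun x => Real.rpow_nonneg (hf0 x) r
  have hg : Measurable fun x => f x ^ r := hf.pow_const r
  have hgn : wNorm (p / r) σ' (fun x => f x ^ r) ≤ 1 := by
    rw [hσ.wNorm_le_one_iff hg hg0 (by apply div_pos <;> linarith)]
    rw [hσ.wNorm_le_one_iff hf hf0 (by linarith)] at hfn
    refine le_of_eq_of_le (lintegral_congr fun x => ?_) hfn
    rw [← Real.rpow_mul (hf0 x), mul_div_cancel₀ _ hr0.ne']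
  refine le_trans ?_ (le_iSup₂_of_le (fun x => f x ^ r) hg (le_iSup₂_of_le hg0 hgn le_rfl))
  refine (eNorm_cubeSum_le (K := 1) (by apply div_pos <;> linarith) ω (by simp)
    fun Q hQ => ?_).trans_eq (one_mul _)
  rw [one_mul, Q.vol_mul_inv_mul, mul_assoc]
  gcongr
  rw [← hσ.setLIntegral_weightMeasure hf hf0, ← hσ.setLIntegral_weightMeasure hg hg0,
    ← weightMeasure_carrier]
  refine (rpow_lintegral_le_measure_rpow_mul _ hf.ennreal_ofReal.aemeasurable hr).trans_eq ?_
  rw [Measure.restrict_apply_univ]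
  simp_rw [ENNReal.ofReal_rpow_of_nonneg (hf0 _) hr0.le]

lemma quantII_le_quantI (hr : 1 < r) (hrp : r < p) (hpq : p ≤ q) (hD : ∀ Q ∈ D, Q.IsDyadic)
    (hσ : IsWeight σ') :
    quantII p q r D ω σ' c ≤
      ENNReal.ofReal ((2 ^ (p / r) * (p / r / (p / r - 1))) ^ (r / p)) *
        quantI p q r D ω σ' c := by
  have hr0 : 0 < r := by linarith
  have hp0 : 0 < p := by linarith
  set s := p / r with hs
  have hs1 : 1 < s := (one_lt_div hr0).2 hrp
  set C := 2 ^ s * (s / (s - 1)) with hC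
  have hC0 : 0 < C := by
    have : 0 < s - 1 := by linarith
    positivity
  set K := C ^ (1 / p) with hK
  have hK0 : 0 < K := by positivity
  have hKp : K ^ p = C := by
    rw [hK, ← Real.rpow_mul hC0.le, one_div_mul_cancel hp0.ne', Real.rpow_one]
  have hKr : C ^ (r / p) = K ^ r := by
    rw [hK, ← Real.rpow_mul hC0.le]; congr 1; ring
  refine iSup_le fun g => iSup_le fun hg => iSup_le fun hg0 => iSup_le fun hgn => ?_
  rw [hσ.wNorm_le_one_iff hg hg0 (by linarith)] at hgn
  set μ := weightMeasure σ' with hμ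
  have hac : μ ≪ volume := withDensity_absolutelyContinuous _ _
  set G : (Fin n → ℝ) → ℝ≥0∞ := fun y => ENNReal.ofReal (g y) with hG
  set M := laminarMax μ dyadicCell G with hM
  have hMm : Measurable M := measurable_laminarMax measurableSet_dyadicCell G
  have hcell : ∀ i : ℤ × (Fin n → ℤ), μ (dyadicCell i) ≠ ⊤ := by
    intro i
    let Q : Cube n := ⟨fun k => (i.2 k : ℝ) * 2 ^ (-i.1), 2 ^ (-i.1), by positivity⟩
    refine ne_top_of_le_ne_top (hσ.weightMeasure_carrier_ne_top Q) (measure_mono ?_)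
    rw [dyadicCell_eq_pi_Ico]
    exact fun x hx k => ⟨(hx k trivial).1, (hx k trivial).2.le⟩
  have hweak : ∀ t : ℝ, 0 < t → ENNReal.ofReal t * μ {x | ENNReal.ofReal t < M x} ≤
      2 * ∫⁻ x in {x | t < 2 * g x}, ENNReal.ofReal (g x) ∂μ := fun t _ =>
    mul_measure_lt_laminarMax_le measurableSet_dyadicCell dyadicCell_nested hcell hg
  have hMtop := ae_lt_top_of_weakType hg hg0 hs1 (ne_top_of_le_ne_top (by simp) hgn) hweak
  have hMs : ∫⁻ x, ENNReal.ofReal ((M x).toReal ^ s) ∂μ ≤ ENNReal.ofReal C :=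
    (lintegral_rpow_le_of_weakType hMm hg hg0 hs1 hweak).trans (mul_le_of_le_one_right' hgn)
  set f : (Fin n → ℝ) → ℝ := fun x => K⁻¹ * (M x).toReal ^ (1 / r) with hf
  have hfm : Measurable f := (hMm.ennreal_toReal.pow_const _).const_mul _
  have hf0 : ∀ x, 0 ≤ f x := fun x => by positivity
  have hfn : wNorm p σ' f ≤ 1 := by
    rw [hσ.wNorm_le_one_iff hfm hf0 hp0]
    have hfp : ∀ x, ENNReal.ofReal (f x ^ p) =
        ENNReal.ofReal C⁻¹ * ENNReal.ofReal ((M x).toReal ^ s) := by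
      intro x
      rw [← ENNReal.ofReal_mul (by positivity), hf]
      congr 1
      simp only
      rw [Real.mul_rpow (by positivity) (by positivity), Real.inv_rpow hK0.le, hKp,
        ← Real.rpow_mul (by positivity), hs]
      congr 2; ring
    simp_rw [hfp]
    rw [lintegral_const_mul' _ _ (by simp)]
    calc _ ≤ ENNReal.ofReal C⁻¹ * ENNReal.ofReal C := by gcongr
      _ = 1 := by rw [← ENNReal.ofReal_mul (by positivity), inv_mul_cancel₀ hC0.ne']; simp
  refine le_trans ?_ (mul_le_mul_right (le_iSup₂_of_le f hfm (le_iSup₂_of_le hf0 hfn le_rfl)) _)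
  refine eNorm_cubeSum_le (by apply div_pos <;> linarith) ω (by simp) fun Q hQ => ?_
  rw [Q.vol_mul_inv_mul, mul_assoc, mul_left_comm (ENNReal.ofReal (C ^ (r / p)))]
  gcongr 1
  rw [← hσ.setLIntegral_weightMeasure hfm hf0, ← hσ.setLIntegral_weightMeasure hg hg0,
    ← weightMeasure_carrier]
  obtain ⟨i, hi⟩ := (hD Q hQ).exists_dyadicCell_ae_eq
  have hiμ : dyadicCell i =ᵐ[μ] Q.carrier := hac.ae_eq hi
  rw [← hμ, ← measure_congr hiμ, ← setLIntegral_congr hiμ, ← setLIntegral_congr hiμ]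
  refine (measure_rpow_mul_setLIntegral_le (measurableSet_dyadicCell i) (hcell i)
    (Filter.Eventually.of_forall fun x hx => average_le_laminarMax G hx) hr).trans_eq ?_
  have hMf : ∫⁻ x in dyadicCell i, M x ^ (1 / r) ∂μ =
      ENNReal.ofReal K * ∫⁻ x in dyadicCell i, ENNReal.ofReal (f x) ∂μ := by
    rw [← lintegral_const_mul' _ _ (by simp)]
    refine lintegral_congr_ae (ae_restrict_of_ae ?_)
    filter_upwards [hMtop] with x hx
    rw [← ENNReal.ofReal_mul hK0.le, hf]
    simp only
    rw [mul_inv_cancel_left₀ hK0.ne', ← ENNReal.ofReal_rpow_of_nonneg (by simp) (by positivity),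
      ENNReal.ofReal_toReal hx.ne]
  rw [← hM, hMf, ENNReal.mul_rpow_of_nonneg _ _ hr0.le,
    ENNReal.ofReal_rpow_of_nonneg hK0.le hr0.le, hKr]

end Comparison

/-- for `1 < r < p ≤ q < ∞` the quantities `I` and `II` are comparable, with
constants depending only on `p` and `r`. -/
theorem stmt4 (p r : ℝ) (hr1 : 1 < r) (hrp : r < p) :
    ∃ C : ℝ, 0 < C ∧
      ∀ q : ℝ, p ≤ q →
      ∀ (n : ℕ), 1 ≤ n →
      ∀ (D : Set (Cube n)), (∀ Q ∈ D, Q.IsDyadic) →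
      ∀ ω σ' : (Fin n → ℝ) → ℝ, IsWeight ω → IsWeight σ' →
      ∀ c : Cube n → ℝ, (∀ Q, 0 ≤ c Q) →
        quantI p q r D ω σ' c ≤ ENNReal.ofReal C * quantII p q r D ω σ' c ∧
        quantII p q r D ω σ' c ≤ ENNReal.ofReal C * quantI p q r D ω σ' c := by
  refine ⟨max 1 ((2 ^ (p / r) * (p / r / (p / r - 1))) ^ (r / p)), by positivity, ?_⟩
  intro q hpq n _ D hD ω σ' _ hσ c _
  constructor
  · refine (quantI_le_quantII hr1 hrp hpq hσ).trans (le_mul_of_one_le_left' ?_)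
    exact ENNReal.one_le_ofReal.2 (le_max_left _ _)
  · refine (quantII_le_quantI hr1 hrp hpq hD hσ).trans ?_
    gcongr
    exact le_max_right _ _
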